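/- Quadratic relation from the Giambelli determinant, skew case (Theorem 3.5(2)): Let R be a commutative ring, N a positive integer, U an N×N upper unitriangular matrix over R, and r an integer. Let λ ⊇ μ be partitions with ℓ(λ) ≤ r, λ_1 ≤ N−r, with Frobenius notations λ = (α|β), α = (α_1 > ⋯ > α_p ≥ 0), β = (β_1 > ⋯ > β_p ≥ 0), and μ = (γ|δ), γ = (γ_1 > ⋯ > γ_q ≥ 0), δ = (δ_1 > ⋯ > δ_q ≥ 0), with q ≥ 1. Then S^{(r)}_{(α|β)/(γ|δ)}(U) · S^{(r)}_{(⁻α|⁻β)/(γ⁻|δ⁻)}(U) = S^{(r)}_{(α|β)/(γ⁻|δ⁻)}(U) · S^{(r)}_{(⁻α|⁻β)/(γ|δ)}(U) + Σ_{i=1}^{p} Σ_{j=1}^{p} (−1)^{i+j} h^{(r+γ_q+1)}_{α_i−γ_q}(U) · e^{(r−δ_q−1)}_{β_j−δ_q}(U) · S^{(r)}_{(α^∨(i)|⁻β)/(γ⁻|δ⁻)}(U) · S^{(r)}_{(⁻α|β^∨(j))/(γ⁻|δ⁻)}(U), where ⁻α = (α_2,…,α_p), γ⁻ = (γ_1,…,γ_{q−1}),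 α^∨(i) = (α_1,…,α_{i−1},α_{i+1},…,α_p), and similarly for β, δ; S^{(r)}_{ν/κ}(U) := 0 whenever ν/κ is not a skew partition. -/

import Mathlib

open Matrix BigOperators Finset Filter

/-- Extend a `Fin N`-indexed matrix to `ℕ` indices by zero. -/
def matExt {R : Type*} [Zero R] {N : ℕ} (U : Matrix (Fin N) (Fin N) R) : ℕ → ℕ → R :=
  fun i j => if hi : i < N then (if hj : j < N then U ⟨i, hi⟩ ⟨j, hj⟩ else 0) else 0

/-- `U` is upper unitriangular. -/
def UpperUni {R : Type*} [Zero R] [One R] {N : ℕ} (U : Matrix (Fin N) (Fin N) R) : Prop :=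
  (∀ i, U i i = 1) ∧ ∀ i j : Fin N, (j : ℕ) < (i : ℕ) → U i j = 0

/-- `L` is lower unitriangular. -/
def LowerUni {R : Type*} [Zero R] [One R] {N : ℕ} (L : Matrix (Fin N) (Fin N) R) : Prop :=
  (∀ i, L i i = 1) ∧ ∀ i j : Fin N, (i : ℕ) < (j : ℕ) → L i j = 0

/-- 0-based entries of the Maya diagram `J(λ;r)` (the `a`-th smallest element, minus 1):
for `a = 0,…,r-1` this is `λ_{r-a} + a` (with `λ` 0-based). -/
def maya (lam : ℕ → ℕ) (r : ℕ) (a : Fin r) : ℕ := lam (r - 1 - (a : ℕ)) + (a : ℕ)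

/-- The ninth variation of the skew Schur function `S^{(r)}_{λ/μ}(U)`:
the minor of `U` on rows `J(μ;r)` and columns `J(λ;r)`. -/
def SchurV {R : Type*} [CommRing R] {N : ℕ} (U : Matrix (Fin N) (Fin N) R)
    (r : ℕ) (lam mu : ℕ → ℕ) : R :=
  Matrix.det (Matrix.of fun i j : Fin r => matExt U (maya mu r i) (maya lam r j))

/-- Conjugate partition (0-based), counting parts among indices `< B`. -/
def conjF (f : ℕ → ℕ) (B : ℕ) : ℕ → ℕ :=
  fun i => ((Finset.range B).filter fun j => i + 1 ≤ f j).card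

/-- The hook partition `(a+1, 1^b)` (0-based function). -/
def hookP (a b : ℕ) : ℕ → ℕ := fun k => if k = 0 then a + 1 else if k ≤ b then 1 else 0

/-- `h^{(r)}_d(U) = S^{(r)}_{(d)}(U)`, zero for `d < 0`. -/
def hSV {R : Type*} [CommRing R] {N : ℕ} (U : Matrix (Fin N) (Fin N) R) (r : ℕ) (d : ℤ) : R :=
  if 0 ≤ d then SchurV U r (fun k => if k = 0 then d.toNat else 0) (fun _ => 0) else 0

/-- `e^{(r)}_d(U) = S^{(r)}_{(1^d)}(U)`, zero for `d < 0`. -/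
def eSV {R : Type*} [CommRing R] {N : ℕ} (U : Matrix (Fin N) (Fin N) R) (r : ℕ) (d : ℤ) : R :=
  if 0 ≤ d then SchurV U r (fun k => if k < d.toNat then 1 else 0) (fun _ => 0) else 0

/-- The partition with Frobenius coordinates `(a|b)` (all 0-based as functions). -/
def frobP (p : ℕ) (a b : Fin p → ℕ) : ℕ → ℕ :=
  fun i => if h : i < p then a ⟨i, h⟩ + i + 1
    else (Finset.univ.filter fun j : Fin p => i < b j + (j : ℕ) + 1).card

/-- `f : ℕ → ℤ` is a partition of length `≤ B`. -/
def IsPartZ (B : ℕ) (f : ℕ → ℤ) : Prop :=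
  (∀ i, f (i + 1) ≤ f i) ∧ (∀ i, 0 ≤ f i) ∧ (∀ i, B ≤ i → f i = 0)

/-- `lam/mu` is a skew partition (of length `≤ B`). -/
def IsSkewZ (B : ℕ) (lam mu : ℕ → ℤ) : Prop :=
  IsPartZ B lam ∧ IsPartZ B mu ∧ ∀ i, mu i ≤ lam i

open Classical in
/-- `S^{(r)}_{λ/μ}(U)` with the convention that it is `0` if `λ/μ` is not a skew partition. -/
noncomputable def SchurVz {R : Type*} [CommRing R] {N : ℕ} (U : Matrix (Fin N) (Fin N) R)
    (r B : ℕ) (lam mu : ℕ → ℤ) : R :=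
  if IsSkewZ B lam mu then SchurV U r (fun i => (lam i).toNat) (fun i => (mu i).toNat) else 0

open Classical in
/-- `S^{(r)}_{λ'/μ'}(U)` applied to the conjugates, with the zero convention. -/
noncomputable def SchurVzConj {R : Type*} [CommRing R] {N : ℕ} (U : Matrix (Fin N) (Fin N) R)
    (r B : ℕ) (lam mu : ℕ → ℤ) : R :=
  if IsSkewZ B lam mu then
    SchurV U r (conjF (fun i => (lam i).toNat) B) (conjF (fun i => (mu i).toNat) B) else 0

/-- `lam/mu` is a skew partition (ℕ-valued version). -/
def IsSkewN (B : ℕ) (lam mu : ℕ → ℕ) : Prop :=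
  (∀ i, lam (i + 1) ≤ lam i) ∧ (∀ i, mu (i + 1) ≤ mu i) ∧ (∀ i, mu i ≤ lam i) ∧
    (∀ i, B ≤ i → lam i = 0)

open Classical in
noncomputable def SchurVn {R : Type*} [CommRing R] {N : ℕ} (U : Matrix (Fin N) (Fin N) R)
    (r B : ℕ) (lam mu : ℕ → ℕ) : R :=
  if IsSkewN B lam mu then SchurV U r lam mu else 0

/-- The rectangular partition `[m|n] = (n^m)`. -/
def rectP (m n : ℕ) : ℕ → ℕ := fun i => if i < m then n else 0

/-- `[m|n]^l = ((n+1)^l, n^{m-l})`. -/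
def rectUpP (m n l : ℕ) : ℕ → ℕ := fun i => if i < l then n + 1 else if i < m then n else 0

/-- `[m|n]_k = (n^m, k)`. -/
def rectLowP (m n k : ℕ) : ℕ → ℕ := fun i => if i < m then n else if i = m then k else 0

/-- `E + c·E_{t,t+1}` (indices 0-based). -/
def elemMat {R : Type*} [CommRing R] (N t : ℕ) (c : R) : Matrix (Fin N) (Fin N) R :=
  1 + Matrix.of (fun i j : Fin N => if (i : ℕ) = t ∧ (j : ℕ) = t + 1 then c else 0)

/-- `U = U_1 ⋯ U_M` with `U_k = (E + w_{k,1-r}E_{1,2}) ⋯ (E + w_{k,N-1-r}E_{N-1,N})`. -/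
def UmatW {R : Type*} [CommRing R] (N M : ℕ) (r : ℤ) (w : ℕ → ℤ → R) :
    Matrix (Fin N) (Fin N) R :=
  ((List.range M).map fun k =>
    ((List.range (N - 1)).map fun t => elemMat N t (w (k + 1) ((t : ℤ) + 1 - r))).prod).prod

/-- The partition `(m_1^{r_1} m_2^{r_2-r_1} ⋯ m_n^{r_n-r_{n-1}})` (corner data 0-based). -/
def stepPart (n : ℕ) (m rr : ℕ → ℕ) : ℕ → ℕ :=
  fun i =>
    if h : (((Finset.range n).filter fun j => i < rr j)).Nonempty then
      m (((Finset.range n).filter fun j => i < rr j).min' h)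
    else 0

/-- `Add_{a,b}` (rows 1-based in `a`, `b`; the function argument is 0-based). -/
def AddOp (a b : ℕ) (k : ℕ → ℕ) : ℕ → ℕ := fun i =>
  if i + 1 ≤ a then k i
  else if i + 1 = a + 1 then k (a - 1)
  else if i + 1 ≤ b + 1 then k (i - 1) + 1
  else k i

/-- `Rem_{a,b}`. -/
def RemOp (a b : ℕ) (k : ℕ → ℕ) : ℕ → ℕ := fun i =>
  if i + 1 < a then k i
  else if i + 1 ≤ b - 1 then k (i + 1) - 1
  else if i + 1 = b then k b
  else k i

/-- `op_{a 0, b 0} ∘ op_{a 1, b 1} ∘ ⋯ ∘ op_{a (t-1), b (t-1)}` applied to `k`. -/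
def iterOp (op : ℕ → ℕ → (ℕ → ℕ) → ℕ → ℕ) (t : ℕ) (a b : ℕ → ℕ) (k : ℕ → ℕ) : ℕ → ℕ :=
  (List.range t).foldr (fun i acc => op (a i) (b i) acc) k

/-- the `i`-th smallest element of a finite set of naturals (0-based). -/
def ascNth (s : Finset ℕ) (i : ℕ) : ℕ := (s.sort (· ≤ ·)).getD i 0

/-- The cells of the skew Young diagram `D(λ/μ)` (0-based, rows `< B`). -/
def cellsD (B : ℕ) (lam mu : ℕ → ℕ) : Finset (ℕ × ℕ) :=
  (Finset.range B ×ˢ Finset.range (lam 0 + 1)).filter fun p => mu p.1 ≤ p.2 ∧ p.2 < lam p.1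

/-- Semistandardness: weakly increasing along rows, strictly increasing down columns. -/
def IsSSYT {M B : ℕ} {lam mu : ℕ → ℕ} (T : ↥(cellsD B lam mu) → Fin M) : Prop :=
  (∀ c c' : ↥(cellsD B lam mu), c.val.1 = c'.val.1 → c.val.2 ≤ c'.val.2 → T c ≤ T c') ∧
  (∀ c c' : ↥(cellsD B lam mu), c.val.1 < c'.val.1 → c.val.2 = c'.val.2 → T c < T c')

open Classical in
/-- Sum over all semistandard tableaux of shape `λ/μ` with entries in `{1,…,M}` of
the product over cells `c` of `f (entry) c`. -/
noncomputable def tabSum {R : Type*} [CommRing R] (M B : ℕ) (lam mu : ℕ → ℕ)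
    (f : ℕ → ℕ × ℕ → R) : R :=
  ∑ T ∈ Finset.univ.filter (fun T : ↥(cellsD B lam mu) → Fin M => IsSSYT T),
    ∏ c : ↥(cellsD B lam mu), f ((T c : ℕ) + 1) c.val

/-- `M`-truncated Schur multiple zeta value for a general filling `s` of the diagram. -/
noncomputable def zetaTF (M B : ℕ) (lam mu : ℕ → ℕ) (s : ℕ × ℕ → ℂ) : ℂ :=
  tabSum M B lam mu fun k c => (k : ℂ) ^ (-(s c))

/-- `M`-truncated diagonally constant Schur multiple zeta value `ζ^M_{λ/μ}(a)`. -/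
noncomputable def zetaT (M B : ℕ) (lam mu : ℕ → ℕ) (a : ℤ → ℂ) : ℂ :=
  zetaTF M B lam mu fun c => a ((c.2 : ℤ) - (c.1 : ℤ))

open Classical in
/-- `ζ^M_{λ/μ}(a)` with the zero convention for non-skew shapes. -/
noncomputable def zetaZ (M B : ℕ) (lam mu : ℕ → ℤ) (a : ℤ → ℂ) : ℂ :=
  if IsSkewZ B lam mu then
    zetaT M B (fun i => (lam i).toNat) (fun i => (mu i).toNat) a else 0

open Classical in
/-- `ζ^M_{λ'/μ'}(a)` applied to conjugates, with the zero convention. -/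
noncomputable def zetaZConj (M B : ℕ) (lam mu : ℕ → ℤ) (a : ℤ → ℂ) : ℂ :=
  if IsSkewZ B lam mu then
    zetaT M (lam 0).toNat (conjF (fun i => (lam i).toNat) B)
      (conjF (fun i => (mu i).toNat) B) a
  else 0

open Classical in
/-- `M`-truncated multiple zeta-star value `ζ^{⋆,M}(s_0,…,s_{d-1})`. -/
noncomputable def zetaStarT (M d : ℕ) (s : ℕ → ℂ) : ℂ :=
  ∑ f ∈ Finset.univ.filter (fun f : Fin d → Fin M => ∀ i j : Fin d, i ≤ j → f i ≤ f j),
    ∏ i : Fin d, (((f i : ℕ) + 1 : ℕ) : ℂ) ^ (-(s i))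

open Classical in
/-- `M`-truncated multiple zeta value `ζ^{M}(s_0,…,s_{d-1})`. -/
noncomputable def zetaMT (M d : ℕ) (s : ℕ → ℂ) : ℂ :=
  ∑ f ∈ Finset.univ.filter (fun f : Fin d → Fin M => ∀ i j : Fin d, i < j → f i < f j),
    ∏ i : Fin d, (((f i : ℕ) + 1 : ℕ) : ℂ) ^ (-(s i))

/-- The Riemann zeta value `ζ(k) = Σ_{n ≥ 1} n^{-k}`. -/
noncomputable def zetaVal (k : ℕ) : ℂ := ∑' n : ℕ, ((n + 1 : ℕ) : ℂ) ^ (-(k : ℤ))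

/-- `ζ^⋆(1,k) = Σ_{1 ≤ m ≤ n} m^{-1} n^{-k}`. -/
noncomputable def zetaStarOne (k : ℕ) : ℂ :=
  ∑' n : ℕ, (∑ m ∈ Finset.Icc 1 (n + 1), ((m : ℂ))⁻¹) * ((n + 1 : ℕ) : ℂ) ^ (-(k : ℤ))

/-! ### Determinants of `ℕ`-indexed arrays -/

/-- Determinant of the leading `n × n` part of an array. -/
def detN {R : Type*} [CommRing R] (n : ℕ) (M : ℕ → ℕ → R) : R :=
  Matrix.det (Matrix.of fun i j : Fin n => M i j)

/-- skip the index `k` -/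
def sk (k i : ℕ) : ℕ := if i < k then i else i + 1

lemma detN_congr {R : Type*} [CommRing R] {n : ℕ} {M M' : ℕ → ℕ → R}
    (h : ∀ i j, i < n → j < n → M i j = M' i j) : detN n M = detN n M' := by
  unfold detN
  congr 1
  ext i j
  exact h i j i.2 j.2

lemma sk_succAbove {n : ℕ} (j : Fin (n + 1)) (i : Fin n) : ((j.succAbove i : Fin (n+1)) : ℕ) = sk j i := by
  unfold sk Fin.succAbove
  simp only [Fin.lt_def, Fin.val_castSucc]
  split_ifs <;> simp

lemma sk_last {n i : ℕ} (h : i < n) : sk n i = i := by simp [sk, h]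

lemma detN_last_row {R : Type*} [CommRing R] (n : ℕ) (M : ℕ → ℕ → R) :
    detN (n + 1) M = ∑ j ∈ range (n + 1), (-1 : R) ^ (n + j) * M n j *
      detN n (fun i j' => M i (sk j j')) := by
  rw [detN, Matrix.det_succ_row _ (Fin.last n), Finset.sum_range]
  refine Finset.sum_congr rfl fun j _ => ?_
  simp only [Fin.val_last, Matrix.of_apply]
  congr 2
  ext a b
  simp [sk_succAbove]

lemma detN_last_col {R : Type*} [CommRing R] (n : ℕ) (M : ℕ → ℕ → R) :
    detN (n + 1) M = ∑ j ∈ range (n + 1), (-1 : R) ^ (n + j) * M j n *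
      detN n (fun i j' => M (sk j i) j') := by
  rw [detN, Matrix.det_succ_column _ (Fin.last n), Finset.sum_range]
  refine Finset.sum_congr rfl fun j _ => ?_
  simp only [Fin.val_last, Matrix.of_apply]
  rw [add_comm (j : ℕ) n]
  congr 2
  ext a b
  simp [sk_succAbove]

/-- cofactor identity, block form -/
lemma jacobi_two_regular {R : Type*} [CommRing R] {m : Type*} [Fintype m] [DecidableEq m]
    (M : Matrix (m ⊕ Fin 2) (m ⊕ Fin 2) R) (hM : IsLeftRegular M.det) :
    M.det * M.toBlocks₁₁.det =
      M.adjugate (Sum.inr 0) (Sum.inr 0) * M.adjugate (Sum.inr 1) (Sum.inr 1) -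
      M.adjugate (Sum.inr 0) (Sum.inr 1) * M.adjugate (Sum.inr 1) (Sum.inr 0) := by
  set A := M.adjugate with hA
  have hMA : M * A = M.det • 1 := Matrix.mul_adjugate M
  have e1 : M = fromBlocks M.toBlocks₁₁ M.toBlocks₁₂ M.toBlocks₂₁ M.toBlocks₂₂ :=
    (fromBlocks_toBlocks M).symm
  have e2 : A = fromBlocks A.toBlocks₁₁ A.toBlocks₁₂ A.toBlocks₂₁ A.toBlocks₂₂ :=
    (fromBlocks_toBlocks A).symm
  have h3 : fromBlocks M.toBlocks₁₁ M.toBlocks₁₂ M.toBlocks₂₁ M.toBlocks₂₂ *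
      fromBlocks A.toBlocks₁₁ A.toBlocks₁₂ A.toBlocks₂₁ A.toBlocks₂₂ =
      fromBlocks (M.det • 1) 0 0 (M.det • 1) := by
    rw [← e1, ← e2, hMA, ← fromBlocks_one, fromBlocks_smul]; simp
  rw [fromBlocks_multiply, fromBlocks_inj] at h3
  obtain ⟨-, h12, -, h22⟩ := h3
  have key : M * fromBlocks 1 A.toBlocks₁₂ 0 A.toBlocks₂₂ =
      fromBlocks M.toBlocks₁₁ 0 M.toBlocks₂₁ (M.det • 1) := by
    conv_lhs => rw [e1]
    rw [fromBlocks_multiply, h12, h22]; simp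
  have := congrArg Matrix.det key
  rw [det_mul, det_fromBlocks_zero₂₁, det_fromBlocks_zero₁₂, det_one, one_mul, det_smul, det_one,
    det_fin_two] at this
  simp only [toBlocks₂₂, of_apply, Fintype.card_fin, mul_one] at this
  apply hM
  simp only
  rw [this]; ring

lemma jacobi_two {R : Type*} [CommRing R] {m : Type*} [Fintype m] [DecidableEq m]
    (M : Matrix (m ⊕ Fin 2) (m ⊕ Fin 2) R) :
    M.det * M.toBlocks₁₁.det =
      M.adjugate (Sum.inr 0) (Sum.inr 0) * M.adjugate (Sum.inr 1) (Sum.inr 1) -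
      M.adjugate (Sum.inr 0) (Sum.inr 1) * M.adjugate (Sum.inr 1) (Sum.inr 0) := by
  have h := jacobi_two_regular (charmatrix (-M)) (by
    have := (Matrix.charpoly_monic (-M)).isRegular.left
    exact this)
  set f := Polynomial.evalRingHom (0 : R)
  have hf : (charmatrix (-M)).map f = M := by
    ext i j
    by_cases hij : i = j
    · subst hij; simp [f]
    · simp [f, hij]
  have h2 := congrArg f h
  have hadj : ∀ i j, f ((charmatrix (-M)).adjugate i j) = M.adjugate i j := by
    intro i j
    have := RingHom.map_adjugate f (charmatrix (-M))
    have h3 := congrFun (congrFun this i) j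
    simp only [RingHom.mapMatrix_apply, Matrix.map_apply] at h3
    rw [h3, hf]
  have hd : f (charmatrix (-M)).det = M.det := by
    rw [RingHom.map_det, RingHom.mapMatrix_apply, hf]
  have hd2 : f (charmatrix (-M)).toBlocks₁₁.det = M.toBlocks₁₁.det := by
    rw [RingHom.map_det, RingHom.mapMatrix_apply]
    congr 1
    conv_rhs => rw [← hf]
    rfl
  simpa only [map_sub, map_mul, hadj, hd, hd2] using h2

/-- The Desnanot-Jacobi identity. -/
lemma desnanot {R : Type*} [CommRing R] (n : ℕ) (M : ℕ → ℕ → R) :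
    detN (n + 2) M * detN n (fun i j => M (i + 1) (j + 1)) =
      detN (n + 1) (fun i j => M (i + 1) (j + 1)) * detN (n + 1) M -
      detN (n + 1) (fun i j => M (i + 1) j) * detN (n + 1) (fun i j => M i (j + 1)) := by
  let g : Fin n ⊕ Fin 2 → Fin (n + 2) :=
    Sum.elim (fun k => k.castSucc.succ) (fun k => if k = 0 then 0 else Fin.last (n + 1))
  have hg : Function.Bijective g := by
    rw [Fintype.bijective_iff_injective_and_card]
    refine ⟨?_, by simp⟩
    rintro (a | a) (b | b) h
    · simpa [g] using h
    · exfalso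
      have ha := a.2
      simp only [g, Sum.elim_inl, Sum.elim_inr, Fin.ext_iff, Fin.val_succ, Fin.val_castSucc] at h
      split_ifs at h <;> simp at h; omega
    · exfalso
      have ha := b.2
      simp only [g, Sum.elim_inl, Sum.elim_inr, Fin.ext_iff, Fin.val_succ, Fin.val_castSucc] at h
      split_ifs at h <;> simp at h; omega
    · fin_cases a <;> fin_cases b
      · rfl
      · exact absurd (congrArg Fin.val h) (Nat.succ_ne_zero n).symm
      · exact absurd (congrArg Fin.val h) (Nat.succ_ne_zero n)
      · rfl
  let e := Equiv.ofBijective g hg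
  set X : Matrix (Fin (n+2)) (Fin (n+2)) R := Matrix.of fun i j => M i j with hX
  have h := jacobi_two (X.submatrix e e)
  rw [Matrix.adjugate_submatrix_equiv_self, det_submatrix_equiv_self] at h
  simp only [submatrix_apply] at h
  have e0 : e (Sum.inr 0) = 0 := rfl
  have e1 : e (Sum.inr 1) = Fin.last (n + 1) := rfl
  rw [e0, e1] at h
  simp only [adjugate_fin_succ_eq_det_submatrix] at h
  have d1 : (X.submatrix e e).toBlocks₁₁.det = detN n (fun i j => M (i + 1) (j + 1)) := by
    rfl
  have d2 : (X.submatrix (Fin.succAbove 0) (Fin.succAbove 0)).det =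
      detN (n + 1) (fun i j => M (i + 1) (j + 1)) := by
    unfold detN; congr 1
  have d3 : (X.submatrix (Fin.last (n+1)).succAbove (Fin.last (n+1)).succAbove).det =
      detN (n + 1) M := by
    unfold detN; congr 1; ext i j; simp [hX]
  have d4 : (X.submatrix (Fin.last (n+1)).succAbove (Fin.succAbove 0)).det =
      detN (n + 1) (fun i j => M i (j + 1)) := by
    unfold detN; congr 1; ext i j; simp [hX]
  have d5 : (X.submatrix (Fin.succAbove 0) (Fin.last (n+1)).succAbove).det =
      detN (n + 1) (fun i j => M (i + 1) j) := by
    unfold detN; congr 1; ext i j; simp [hX]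
  rw [d1, d2, d3, d4, d5] at h
  have d0 : X.det = detN (n + 2) M := rfl
  rw [d0] at h
  rw [h]
  simp only [Fin.val_last, Fin.val_zero, zero_add, add_zero, pow_zero, one_mul]
  have s1 : ((-1 : R) ^ (n + 1)) * (-1) ^ (n + 1) = 1 := by
    rw [← pow_add, ← two_mul, pow_mul]; simp
  have s2 : ((-1 : R) ^ (n + 1 + (n + 1))) = 1 := by rw [pow_add, s1]
  rw [s2]
  linear_combination (-detN (n + 1) (fun i j => M (i + 1) j) *
    detN (n + 1) (fun i j => M i (j + 1))) * s1

/-- The determinant with a set of columns replaced, as a bordered determinant. -/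
lemma swap_cols {R : Type*} [CommRing R] {m n : Type*} [Fintype m] [DecidableEq m]
    [Fintype n] [DecidableEq n] (P P' : Matrix m m R) (Q : Matrix m n R) (b : n → m)
    (hb : Function.Injective b) (h1 : ∀ i j, P' i (b j) = Q i j)
    (h2 : ∀ i c, (∀ j, c ≠ b j) → P' i c = P i c) :
    det (fromBlocks P Q (of fun j i => if i = b j then 1 else 0) 0) =
      (-1) ^ Fintype.card n * det P' := by
  set E : Matrix n m R := of fun j i => if i = b j then 1 else 0 with hE
  have hEE : E * Eᵀ = 1 := by
    ext i j
    simp [hE, Matrix.mul_apply, Matrix.one_apply, hb.eq_iff, eq_comm]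
  have hdW : det (fromBlocks (1 - Eᵀ * E) Eᵀ E 0) = (-1) ^ Fintype.card n := by
    have : fromBlocks 1 Eᵀ 0 1 * fromBlocks (1 - Eᵀ * E) Eᵀ E 0 = fromBlocks 1 Eᵀ E 0 := by
      rw [fromBlocks_multiply]; simp
    have h := congrArg det this
    rw [det_mul, det_fromBlocks_zero₂₁, det_fromBlocks_one₁₁] at h
    simp only [det_one, one_mul, hEE, zero_sub] at h
    rw [h, det_neg, det_one, mul_one]
  have hP : P * (1 - Eᵀ * E) + Q * E = P' := by
    ext i c
    have hQE : ∀ c, (Q * E) i c = ∑ j, if c = b j then Q i j else 0 := by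
      intro c; simp [Matrix.mul_apply, hE]
    have hPE : (P * Eᵀ * E) i c = ∑ j, if c = b j then P i c else 0 := by
      rw [Matrix.mul_apply]
      refine Finset.sum_congr rfl fun j _ => ?_
      simp [hE, Matrix.mul_apply]
      split_ifs with h <;> simp [h]
    rw [Matrix.mul_sub, Matrix.mul_one, ← Matrix.mul_assoc, Matrix.add_apply, Matrix.sub_apply, hPE, hQE]
    by_cases hc : ∃ j, c = b j
    · obtain ⟨j, rfl⟩ := hc
      simp [hb.eq_iff, h1]
    · push Not at hc
      simp [hc, h2 i c hc]
  have hm : fromBlocks P Q E 0 * fromBlocks (1 - Eᵀ * E) Eᵀ E 0 = fromBlocks P' (P * Eᵀ) 0 1 := by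
    rw [fromBlocks_multiply]
    rw [hP]
    congr 1
    · simp
    · rw [Matrix.mul_sub, ← Matrix.mul_assoc, hEE]; simp
    · simp [hEE]
  have h := congrArg det hm
  rw [det_mul, hdW, det_fromBlocks_zero₂₁, det_one, mul_one] at h
  rw [← h, mul_comm _ ((-1 : R) ^ _), ← mul_assoc, ← pow_add, ← two_mul, pow_mul]
  simp

/-- The same for rows. -/
lemma swap_rows {R : Type*} [CommRing R] {m n : Type*} [Fintype m] [DecidableEq m]
    [Fintype n] [DecidableEq n] (P P' : Matrix m m R) (Q : Matrix n m R) (b : n → m)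
    (hb : Function.Injective b) (h1 : ∀ i j, P' (b j) i = Q j i)
    (h2 : ∀ i c, (∀ j, c ≠ b j) → P' c i = P c i) :
    det (fromBlocks P (of fun i j => if i = b j then 1 else 0) Q 0) =
      (-1) ^ Fintype.card n * det P' := by
  rw [← det_transpose, fromBlocks_transpose, ← det_transpose P']
  exact swap_cols Pᵀ P'ᵀ Qᵀ b hb (fun i j => h1 i j) (fun i c h => h2 i c h)

/-! ### Frobenius coordinates and Maya diagrams -/

/-- The first `p` terms of the sequence are strictly decreasing. -/
def SA (p : ℕ) (a : ℕ → ℕ) : Prop := ∀ i j, i < j → j < p → a j < a i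

/-- `frobP` for `ℕ`-indexed sequences -/
def frobN (p : ℕ) (a b : ℕ → ℕ) : ℕ → ℕ :=
  frobP p (fun j : Fin p => a j) (fun j : Fin p => b j)

lemma SA.shift {p : ℕ} {a : ℕ → ℕ} (h : SA (p + 1) a) : SA p (fun i => a (i + 1)) :=
  fun i j hij hj => h _ _ (by omega) (by omega)

lemma SA.init {p : ℕ} {a : ℕ → ℕ} (h : SA (p + 1) a) : SA p a :=
  fun i j hij hj => h _ _ hij (by omega)

lemma SA.skip {p : ℕ} {a : ℕ → ℕ} (h : SA (p + 1) a) (k : ℕ) : SA p (fun i => a (sk k i)) := by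
  intro i j hij hj
  apply h <;> unfold sk <;> split_ifs <;> omega

lemma SA.le_zero {p : ℕ} {a : ℕ → ℕ} (h : SA p a) : ∀ j, j < p → a j + j ≤ a 0 := by
  intro j
  induction j with
  | zero => intro _; omega
  | succ k ih =>
    intro hk
    have := ih (by omega)
    have := h k (k + 1) (by omega) hk
    omega

lemma frobN_succ_zero (p : ℕ) (a b : ℕ → ℕ) : frobN (p + 1) a b 0 = a 0 + 1 := by
  simp [frobN, frobP]

lemma frobN_succ_succ (p : ℕ) (a b : ℕ → ℕ) (hb : SA (p + 1) b) (i : ℕ) :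
    frobN (p + 1) a b (i + 1) =
      frobN p (fun j => a (j + 1)) (fun j => b (j + 1)) i + if i < b 0 then 1 else 0 := by
  unfold frobN frobP
  by_cases hi : i < p
  · have := hb.le_zero p (by omega)
    rw [dif_pos (by omega), dif_pos hi, if_pos (by omega)]
    simp only
    omega
  · rw [dif_neg (by omega), dif_neg hi]
    simp only [Finset.card_filter]
    rw [Fin.sum_univ_succ, add_comm]
    congr 1
    · refine Finset.sum_congr rfl fun x _ => ?_
      simp only [Fin.val_succ]
      congr 1
      simp only [eq_iff_iff]; omega
    · simp

lemma frobN_zero (a b : ℕ → ℕ) (i : ℕ) : frobN 0 a b i = 0 := by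
  simp [frobN, frobP]

lemma frobN_eq_zero : ∀ (p : ℕ) (a b : ℕ → ℕ) (_ : SA p b) (i : ℕ) (_ : ∀ j, j < p → b j < i),
    frobN p a b i = 0 := by
  intro p
  induction p with
  | zero => intro a b _ i _; exact frobN_zero a b i
  | succ p ih =>
    intro a b hb i hi
    have h0 := hi 0 (by omega)
    obtain ⟨k, rfl⟩ : ∃ k, i = k + 1 := ⟨i - 1, by omega⟩
    rw [frobN_succ_succ p a b hb, if_neg (by omega), ih _ _ hb.shift]
    intro j hj
    have := hb 0 (j + 1) (by omega) (by omega)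
    omega

lemma frobN_anti : ∀ (p : ℕ) (a b : ℕ → ℕ) (_ : SA p a) (_ : SA p b) (i : ℕ),
    frobN p a b (i + 1) ≤ frobN p a b i := by
  intro p
  induction p with
  | zero => intro a b _ _ i; simp [frobN_zero]
  | succ p ih =>
    intro a b ha hb i
    rw [frobN_succ_succ p a b hb]
    cases i with
    | zero =>
      rw [frobN_succ_zero]
      cases p with
      | zero => rw [frobN_zero]; split_ifs <;> omega
      | succ p =>
        rw [frobN_succ_zero]
        have := ha 0 1 (by omega) (by omega)
        simp only [zero_add]
        split_ifs <;> omega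
    | succ i =>
      rw [frobN_succ_succ p a b hb]
      have := ih _ _ ha.shift hb.shift i
      split_ifs <;> omega

lemma frobN_pos (p : ℕ) (a b : ℕ → ℕ) (hp : 0 < p) : 0 < frobN p a b (b 0) := by
  unfold frobN frobP
  split_ifs with h
  · omega
  · rw [Finset.card_pos]
    exact ⟨⟨0, hp⟩, by simp⟩

lemma maya_perm (r : ℕ) : ∀ (p : ℕ) (a b : ℕ → ℕ) (_ : SA p b) (_ : ∀ j, j < p → b j + 1 ≤ r),
    ∃ σ : Equiv.Perm (Fin r),
      ((Equiv.Perm.sign σ : ℤˣ) : ℤ) = ∏ j ∈ range p, (-1 : ℤ) ^ (b j) ∧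
      (∀ j, j < p → ∀ k : Fin r, (k : ℕ) = r - 1 - b j → maya (frobN p a b) r (σ k) = r + a j) ∧
      (∀ k : Fin r, (∀ j, j < p → (k : ℕ) ≠ r - 1 - b j) → maya (frobN p a b) r (σ k) = k) ∧
      (∀ k : Fin r, (∀ j, j < p → (k : ℕ) < r - 1 - b j) → σ k = k) := by
  intro p
  induction p with
  | zero =>
    intro a b _ _
    refine ⟨1, by simp, by simp, ?_, by simp⟩
    intro k _
    simp [maya, frobN_zero]
  | succ p ih =>
    intro a b hb hr
    obtain ⟨σ', hs, h1, h2, h3⟩ := ih (fun j => a (j + 1)) (fun j => b (j + 1)) hb.shift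
      (fun j hj => hr _ (by omega))
    have hr0 := hr 0 (by omega)
    have hlt : ∀ j, j < p → b (j + 1) < b 0 := fun j hj => hb _ _ (by omega) (by omega)
    have hrj : ∀ j, j < p → b (j + 1) + 1 ≤ r := fun j hj => hr _ (by omega)
    have : NeZero r := ⟨by omega⟩
    let k0 : Fin r := ⟨r - 1 - b 0, by omega⟩
    let kl : Fin r := ⟨r - 1, by omega⟩
    have hk0l : k0 ≤ kl := by simp only [k0, kl, Fin.le_def]; omega
    let c : Equiv.Perm (Fin r) := (Fin.cycleIcc k0 kl)⁻¹
    have hc0 : c k0 = kl := by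
      simp only [c]
      rw [Equiv.Perm.inv_eq_iff_eq, Fin.cycleIcc_of_last hk0l]
    have hclt : ∀ k : Fin r, k < k0 → c k = k := by
      intro k hk
      simp only [c]
      rw [Equiv.Perm.inv_eq_iff_eq, Fin.cycleIcc_of_lt hk]
    have hcgt : ∀ k : Fin r, k0 < k → ((c k : Fin r) : ℕ) + 1 = k := by
      intro k hk
      have hk' : (r - 1 - b 0 : ℕ) < k := hk
      have hkr := k.2
      let k' : Fin r := ⟨k - 1, by omega⟩
      have : c k = k' := by
        simp only [c]
        rw [Equiv.Perm.inv_eq_iff_eq, Fin.cycleIcc_of_ge_of_lt]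
        · ext
          rw [Fin.val_add_one_of_lt']
          · simp only [k']; omega
          · simp only [k']; omega
        · simp only [k0, k', Fin.le_def]; omega
        · simp only [kl, k', Fin.lt_def]; omega
      rw [this]; simp only [k']; omega
    have hfix : σ' k0 = k0 := h3 k0 (by intro j hj; have := hlt j hj; have := hrj j hj; simp only [k0]; omega)
    -- compare the two Maya diagrams
    have hm0 : maya (frobN (p + 1) a b) r kl = r + a 0 := by
      simp only [maya, kl]
      rw [Nat.sub_self, frobN_succ_zero]; omega
    have hm : ∀ k : Fin r, k ≠ k0 → maya (frobN (p + 1) a b) r (c k) =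
        maya (frobN p (fun j => a (j + 1)) (fun j => b (j + 1))) r k := by
      intro k hk
      have hkr := k.2
      rcases lt_or_gt_of_ne hk with h | h
      · rw [hclt k h]
        have h' : (k : ℕ) < r - 1 - b 0 := h
        unfold maya
        obtain ⟨i, hi⟩ : ∃ i, r - 1 - (k : ℕ) = i + 1 := ⟨r - 1 - k - 1, by omega⟩
        rw [hi, frobN_succ_succ p a b hb, if_neg (by omega),
          frobN_eq_zero p _ _ hb.shift i, frobN_eq_zero p _ _ hb.shift (i + 1)]
        · intro j hj; have := hlt j hj; omega
        · intro j hj; have := hlt j hj; omega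
      · have h' : r - 1 - b 0 < (k : ℕ) := h
        have hck := hcgt k h
        unfold maya
        have e : r - 1 - ((c k : Fin r) : ℕ) = (r - 1 - (k : ℕ)) + 1 := by omega
        rw [e, frobN_succ_succ p a b hb, if_pos (by omega)]
        omega
    have hne : ∀ k, k ≠ k0 → σ' k ≠ k0 := by
      intro k hk h
      exact hk (σ'.injective (h.trans hfix.symm))
    refine ⟨c * σ', ?_, ?_, ?_, ?_⟩
    · rw [Finset.prod_range_succ', Equiv.Perm.sign_mul, Units.val_mul, hs, mul_comm]
      congr 1
      simp only [c, Equiv.Perm.sign_inv]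
      rw [Fin.sign_cycleIcc_of_le hk0l]
      simp only [k0, kl, Units.val_pow_eq_pow_val, Units.val_neg, Units.val_one]
      congr 1
      omega
    · intro j hj k hk
      rw [Equiv.Perm.mul_apply]
      cases j with
      | zero =>
        have : k = k0 := Fin.ext hk
        rw [this, hfix, hc0, hm0]
      | succ j =>
        have hkk : k ≠ k0 := by
          intro h
          have h' : (k : ℕ) = r - 1 - b 0 := by rw [h]
          have := hlt j (by omega)
          omega
        rw [hm _ (hne k hkk)]
        exact h1 j (by omega) k hk
    · intro k hk
      rw [Equiv.Perm.mul_apply]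
      have hkk : k ≠ k0 := fun h => hk 0 (by omega) (by rw [h])
      rw [hm _ (hne k hkk)]
      exact h2 k (fun j hj => hk (j + 1) (by omega))
    · intro k hk
      rw [Equiv.Perm.mul_apply, h3 k (fun j hj => hk (j + 1) (by omega))]
      exact hclt k (hk 0 (by omega))

/-! ### Vanishing of minors of triangular matrices -/

lemma det_zero_block {R : Type*} [CommRing R] {r : ℕ} (M : Matrix (Fin r) (Fin r) R) (k : Fin r)
    (h : ∀ i j : Fin r, k ≤ i → j ≤ k → M i j = 0) : M.det = 0 := by
  rw [Matrix.det_apply]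
  refine Finset.sum_eq_zero fun σ _ => ?_
  have : ∃ j : Fin r, j ≤ k ∧ k ≤ σ j := by
    by_contra hcon
    push Not at hcon
    have h1 : (Finset.Iic k).card ≤ (Finset.Iio k).card := by
      refine Finset.card_le_card_of_injOn σ ?_ σ.injective.injOn
      intro j hj
      simp only [Finset.coe_Iic, Set.mem_Iic] at hj
      simpa using hcon j hj
    rw [Fin.card_Iic, Fin.card_Iio] at h1
    omega
  obtain ⟨j, hj, hj'⟩ := this
  have hz : ∏ i, M (σ i) i = 0 := Finset.prod_eq_zero (Finset.mem_univ j) (h _ _ hj' hj)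
  rw [hz, smul_zero]

lemma matExt_lower {R : Type*} [CommRing R] {N : ℕ} {U : Matrix (Fin N) (Fin N) R}
    (hU : UpperUni U) {i j : ℕ} (h : j < i) : matExt U i j = 0 := by
  unfold matExt
  split_ifs with hi hj
  · exact hU.2 _ _ h
  · rfl
  · rfl

lemma matExt_diag {R : Type*} [CommRing R] {N : ℕ} {U : Matrix (Fin N) (Fin N) R}
    (hU : UpperUni U) {i : ℕ} (h : i < N) : matExt U i i = 1 := by
  unfold matExt
  simp [h, hU.1]

lemma maya_mono {lam : ℕ → ℕ} (h : ∀ i, lam (i + 1) ≤ lam i) {r : ℕ} {i j : Fin r} (hij : i ≤ j) :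
    maya lam r i ≤ maya lam r j := by
  have ha : Antitone lam := antitone_nat_of_succ_le h
  have hij' : (i : ℕ) ≤ j := hij
  have := @ha (r - 1 - j) (r - 1 - i) (by omega)
  unfold maya
  omega

lemma SchurVn_eq {R : Type*} [CommRing R] {N : ℕ} {U : Matrix (Fin N) (Fin N) R}
    (hU : UpperUni U) (r : ℕ) (lam mu : ℕ → ℕ) (h1 : ∀ i, lam (i + 1) ≤ lam i)
    (h2 : ∀ i, mu (i + 1) ≤ mu i) (h3 : ∀ i, r ≤ i → lam i = 0) (h4 : ∀ i, r ≤ i → mu i = 0) :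
    SchurVn U r r lam mu = SchurV U r lam mu := by
  unfold SchurVn
  split_ifs with h
  · rfl
  · have : ∃ i, lam i < mu i := by
      by_contra hcon
      push Not at hcon
      exact h ⟨h1, h2, hcon, h3⟩
    obtain ⟨i, hi⟩ := this
    have hir : i < r := by
      by_contra hcon
      rw [h3 i (by omega), h4 i (by omega)] at hi
      omega
    symm
    unfold SchurV
    refine det_zero_block _ ⟨r - 1 - i, by omega⟩ ?_
    intro x y hx hy
    rw [Matrix.of_apply]
    apply matExt_lower hU
    have e1 := maya_mono h1 hy
    have e2 := maya_mono h2 hx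
    have e3 : maya lam r ⟨r - 1 - i, by omega⟩ < maya mu r ⟨r - 1 - i, by omega⟩ := by
      unfold maya
      have : r - 1 - (r - 1 - i) = i := by omega
      simp only [this]
      omega
    omega

/-! ### The inverse matrix and the one-row / one-column functions -/

/-- entries of the inverse of an upper unitriangular array -/
def Vinv {R : Type*} [CommRing R] (u : ℕ → ℕ → R) (b d : ℕ) : R :=
  if b ≤ d then (-1 : R) ^ (b + d) * detN d (fun i j => u i (sk b j)) else 0

lemma detN_upper {R : Type*} [CommRing R] (n : ℕ) (u : ℕ → ℕ → R)
    (hl : ∀ i j, j < i → i < n → u i j = 0) : detN n u = ∏ i ∈ range n, u i i := by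
  unfold detN
  rw [Matrix.det_of_isUpperTriangular, Finset.prod_range]
  · rfl
  · intro i j hij
    exact hl _ _ hij i.2

lemma Vinv_spec {R : Type*} [CommRing R] (u : ℕ → ℕ → R) (r : ℕ)
    (hl : ∀ i j, j < i → u i j = 0) (hd : ∀ i, i < r → u i i = 1) (i d : ℕ)
    (hdr : d < r) : ∑ b ∈ range r, u i b * Vinv u b d = if i = d then 1 else 0 := by
  have hs : ∑ b ∈ range r, u i b * Vinv u b d = ∑ b ∈ range (d + 1), u i b * Vinv u b d := by
    symm
    apply Finset.sum_subset
    · intro x; simp only [mem_range]; omega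
    · intro x _ hx
      simp only [mem_range] at hx
      rw [Vinv, if_neg (by omega), mul_zero]
  rw [hs]
  rcases lt_trichotomy i d with h | h | h
  · rw [if_neg (by omega)]
    have key := detN_last_row d (fun x y => if x = d then u i y else u x y)
    have hz : detN (d + 1) (fun x y => if x = d then u i y else u x y) = 0 := by
      unfold detN
      refine Matrix.det_zero_of_row_eq (i := ⟨i, by omega⟩) (j := ⟨d, by omega⟩) ?_ ?_
      · simp; omega
      · ext y; simp
    rw [hz] at key
    rw [key]
    refine Finset.sum_congr rfl fun b hb => ?_
    simp only [mem_range] at hb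
    rw [Vinv, if_pos (by omega)]
    have : detN d (fun x y => if x = d then u i (sk b y) else u x (sk b y)) =
        detN d (fun x y => u x (sk b y)) :=
      detN_congr fun x y hx _ => if_neg (by omega)
    rw [this, add_comm b d]
    simp only [if_true]; ring
  · subst h
    rw [if_pos rfl]
    have key := detN_last_row i u
    rw [detN_upper _ _ (fun i j h _ => hl i j h), Finset.prod_eq_one] at key
    · rw [key]
      refine Finset.sum_congr rfl fun b hb => ?_
      simp only [mem_range] at hb
      rw [Vinv, if_pos (by omega), add_comm b i]; ring
    · intro k hk
      simp only [mem_range] at hk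
      exact hd k (by omega)
  · rw [if_neg (by omega)]
    refine Finset.sum_eq_zero fun b hb => ?_
    simp only [mem_range] at hb
    rw [hl i b (by omega), zero_mul]

lemma hSV_eq {R : Type*} [CommRing R] {N : ℕ} {U : Matrix (Fin N) (Fin N) R}
    (hU : UpperUni U) (r a c : ℕ) (hc : r + c ≤ N) :
    hSV U (r + c + 1) ((a : ℤ) - (c : ℤ)) = matExt U (r + c) (r + a) := by
  unfold hSV
  split_ifs with h
  · have hca : c ≤ a := by omega
    have hd : ((a : ℤ) - (c : ℤ)).toNat = a - c := by omega
    rw [hd]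
    have : SchurV U (r + c + 1) (fun k => if k = 0 then a - c else 0) (fun _ => 0) =
        detN (r + c + 1) (fun i j => matExt U i (if j = r + c then r + a else j)) := by
      unfold SchurV detN
      congr 1
      ext i j
      simp only [Matrix.of_apply, maya, zero_add]
      congr 1
      have := j.2
      split_ifs <;> omega
    rw [this, detN_upper]
    · rw [Finset.prod_range_succ, Finset.prod_eq_one, one_mul, if_pos rfl]
      intro k hk
      simp only [mem_range] at hk
      rw [if_neg (by omega), matExt_diag hU (by omega)]
    · intro i j hij hj
      rw [if_neg (by omega), matExt_lower hU hij]
  · rw [matExt_lower hU (by omega)]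

lemma eSV_eq {R : Type*} [CommRing R] {N : ℕ} (U : Matrix (Fin N) (Fin N) R)
    (r b d : ℕ) (hb : b < r) (hd : d < r) :
    eSV U (r - d - 1) ((b : ℤ) - (d : ℤ)) =
      (-1 : R) ^ (b + d) * Vinv (matExt U) (r - 1 - b) (r - 1 - d) := by
  unfold eSV Vinv
  split_ifs with h h1 h1
  · have hdb : ((b : ℤ) - (d : ℤ)).toNat = b - d := by omega
    rw [hdb, ← mul_assoc, ← pow_add]
    have e : b + d + (r - 1 - b + (r - 1 - d)) = 2 * (r - 1) := by omega
    rw [e, pow_mul, neg_one_sq, one_pow, one_mul]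
    have e2 : r - 1 - d = r - d - 1 := by omega
    rw [e2]
    unfold SchurV detN
    congr 1
    ext i j
    simp only [Matrix.of_apply, maya, zero_add, sk]
    congr 1
    have := j.2
    split_ifs <;> omega
  · omega
  · omega
  · simp

/-! ### The Giambelli determinant -/

/-- The Giambelli matrix. -/
def GM {R : Type*} [CommRing R] (u : ℕ → ℕ → R) (r p : ℕ) (a b c d : ℕ → ℕ) : ℕ → ℕ → R :=
  fun i j =>
    if i < p then
      if j < p then
        (-1) ^ (b i) * ∑ k ∈ range r, Vinv u (r - 1 - b i) k * u k (r + a j)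
      else (-1) ^ (b i + d (j - p)) * Vinv u (r - 1 - b i) (r - 1 - d (j - p))
    else if j < p then u (r + c (i - p)) (r + a j) else 0

lemma giambelli {R : Type*} [CommRing R] {N : ℕ} {U : Matrix (Fin N) (Fin N) R}
    (hU : UpperUni U) (r p q : ℕ) (hrN : r ≤ N) (a b c d : ℕ → ℕ)
    (hb : SA p b) (hd : SA q d) (hbr : ∀ j, j < p → b j + 1 ≤ r) (hdr : ∀ j, j < q → d j + 1 ≤ r) :
    SchurV U r (frobN p a b) (frobN q c d) =
      (-1) ^ q * detN (p + q) (GM (matExt U) r p a b c d) := by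
  obtain ⟨σ, hσ, hσ1, hσ2, -⟩ := maya_perm r p a b hb hbr
  obtain ⟨τ, hτ, hτ1, hτ2, -⟩ := maya_perm r q c d hd hdr
  set u := matExt U with hu
  have hl : ∀ i j, j < i → u i j = 0 := fun i j h => matExt_lower hU h
  have hdiag : ∀ i, i < r → u i i = 1 := fun i h => matExt_diag hU (by omega)
  let fl : Fin r → ℕ := fun k => maya (frobN p a b) r (σ k)
  let fm : Fin r → ℕ := fun k => maya (frobN q c d) r (τ k)
  let bh : Fin p → Fin r := fun j => ⟨r - 1 - b j, by have := hbr j j.2; omega⟩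
  let dh : Fin q → Fin r := fun j => ⟨r - 1 - d j, by have := hdr j j.2; omega⟩
  have injb : Function.Injective bh := by
    intro x y hxy
    have h := congrArg Fin.val hxy
    simp only [bh] at h
    have h1 := hbr x x.2
    have h2 := hbr y y.2
    rcases lt_trichotomy x y with h3 | h3 | h3
    · have := hb x y h3 y.2; omega
    · exact h3
    · have := hb y x h3 x.2; omega
  have injd : Function.Injective dh := by
    intro x y hxy
    have h := congrArg Fin.val hxy
    simp only [dh] at h
    have h1 := hdr x x.2
    have h2 := hdr y y.2
    rcases lt_trichotomy x y with h3 | h3 | h3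
    · have := hd x y h3 y.2; omega
    · exact h3
    · have := hd y x h3 x.2; omega
  have fl1 : ∀ j : Fin p, fl (bh j) = r + a j := fun j => hσ1 j j.2 _ rfl
  have fl2 : ∀ k, (∀ j, k ≠ bh j) → fl k = k := fun k hk =>
    hσ2 k (fun j hj h => hk ⟨j, hj⟩ (Fin.ext h))
  have fm1 : ∀ j : Fin q, fm (dh j) = r + c j := fun j => hτ1 j j.2 _ rfl
  have fm2 : ∀ k, (∀ j, k ≠ dh j) → fm k = k := fun k hk =>
    hτ2 k (fun j hj h => hk ⟨j, hj⟩ (Fin.ext h))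
  let D : Matrix (Fin r) (Fin r) R := of fun i j => u (fm i) (fl j)
  let S : Matrix (Fin r) (Fin r) R :=
    of fun i j => u (maya (frobN q c d) r i) (maya (frobN p a b) r j)
  have hS : SchurV U r (frobN p a b) (frobN q c d) = S.det := rfl
  let sb : R := ∏ j ∈ range p, (-1 : R) ^ (b j)
  let sd : R := ∏ j ∈ range q, (-1 : R) ^ (d j)
  have hD : D.det = sb * sd * S.det := by
    have e : D = (S.submatrix τ id).submatrix id σ := rfl
    rw [e, Matrix.det_permute', Matrix.det_permute, hσ, hτ]
    simp only [sb, sd]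
    push_cast
    ring
  let P0 : Matrix (Fin r) (Fin r) R := of fun i j => u i j
  let QA : Matrix (Fin r) (Fin p) R := of fun i j => u i (r + a j)
  let EB : Matrix (Fin p) (Fin r) R := of fun j i => if i = bh j then 1 else 0
  let X2 : Matrix (Fin r ⊕ Fin p) (Fin r ⊕ Fin p) R :=
    fromBlocks (of fun i j => u (fm i) j) (of fun i j => u (fm i) (r + a j)) EB 0
  have hX2 : X2.det = (-1) ^ p * D.det := by
    have := swap_cols (of fun i (j : Fin r) => u (fm i) j) D
      (of fun i (j : Fin p) => u (fm i) (r + a j)) bh injb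
      (by intro i j; simp only [D, of_apply, fl1])
      (by intro i k hk; simp only [D, of_apply, fl2 k hk])
    rw [Fintype.card_fin] at this
    exact this
  let CR : Matrix (Fin q) (Fin r ⊕ Fin p) R :=
    of fun k => Sum.elim (fun _ => 0) (fun j => u (r + c k) (r + a j))
  let X1 : Matrix ((Fin r ⊕ Fin p) ⊕ Fin q) ((Fin r ⊕ Fin p) ⊕ Fin q) R :=
    fromBlocks (fromBlocks P0 QA EB 0)
      (of fun i k => if i = Sum.inl (dh k) then 1 else 0) CR 0
  have hX1 : X1.det = (-1) ^ q * X2.det := by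
    have := swap_rows (fromBlocks P0 QA EB 0) X2 CR (fun k => Sum.inl (dh k))
      (Sum.inl_injective.comp injd)
      (by
        rintro (i | i) j
        · simp only [X2, CR, fromBlocks_apply₁₁, of_apply, Sum.elim_inl, fm1]
          exact hl _ _ (by have := i.2; omega)
        · simp only [X2, CR, fromBlocks_apply₁₂, of_apply, Sum.elim_inr, fm1])
      (by
        rintro i (k | k) hk
        · have := fm2 k (fun j h => hk j (by rw [h]))
          rcases i with i | i <;> simp [X2, P0, QA, this]
        · rcases i with i | i <;> simp [X2])
    rw [Fintype.card_fin] at this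
    exact this
  let B1 : Matrix (Fin r) (Fin p ⊕ Fin q) R :=
    of fun i => Sum.elim (fun j => u i (r + a j)) (fun k => if i = dh k then 1 else 0)
  let C1 : Matrix (Fin p ⊕ Fin q) (Fin r) R :=
    of (Sum.elim (fun j i => if i = bh j then 1 else 0) (fun _ _ => 0))
  let D1 : Matrix (Fin p ⊕ Fin q) (Fin p ⊕ Fin q) R :=
    fromBlocks 0 0 (of fun k j => u (r + c k) (r + a j)) 0
  have hX0 : X1.det = (fromBlocks P0 B1 C1 D1).det := by
    rw [← Matrix.det_submatrix_equiv_self (Equiv.sumAssoc (Fin r) (Fin p) (Fin q))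
      (fromBlocks P0 B1 C1 D1)]
    congr 1
    ext i j
    rcases i with (i | i) | i <;> rcases j with (j | j) | j <;>
      simp [X1, P0, B1, C1, D1, QA, EB, CR]
  let V : Matrix (Fin r) (Fin r) R := of fun i j => Vinv u i j
  have hPV : P0 * V = 1 := by
    ext i j
    rw [Matrix.mul_apply, Matrix.one_apply]
    have := Vinv_spec u r hl hdiag i j j.2
    rw [Finset.sum_range] at this
    simp only [P0, V, of_apply, this, Fin.ext_iff]
  let _ : Invertible P0 := invertibleOfRightInverse P0 V hPV
  have hinv : ⅟P0 = V := rfl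
  have hdP : P0.det = 1 := by
    have := detN_upper r u (fun i j h _ => hl i j h)
    rw [Finset.prod_eq_one (fun i hi => hdiag i (by simpa using hi))] at this
    exact this
  have hSch : X1.det = (D1 - C1 * V * B1).det := by
    rw [hX0, det_fromBlocks₁₁, hdP, one_mul, hinv]
  have hent : C1 * V = of (Sum.elim (fun j k => V (bh j) k) (fun _ _ => 0)) := by
    ext i k
    rcases i with i | i <;> simp [Matrix.mul_apply, C1]
  let v : Fin p ⊕ Fin q → R := Sum.elim (fun j => -(-1) ^ (b j)) (fun _ => 1)
  let w : Fin p ⊕ Fin q → R := Sum.elim (fun _ => 1) (fun k => (-1) ^ (d k))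
  have hG : detN (p + q) (GM u r p a b c d) =
      (∏ i, v i) * ((∏ i, w i) * (D1 - C1 * V * B1).det) := by
    rw [← det_mul_row, ← det_mul_column, detN, ← Matrix.det_submatrix_equiv_self finSumFinEquiv]
    congr 1
    ext i j
    rw [hent]
    rcases i with i | i <;> rcases j with j | j
    · simp [GM, v, w, D1, B1, Matrix.mul_apply, Finset.sum_range, V, bh]
    · simp [GM, v, w, D1, B1, Matrix.mul_apply, V, bh, dh, pow_add, mul_assoc]
    · simp [GM, v, w, D1, B1, Matrix.mul_apply]
    · simp [GM, v, w, D1, B1, Matrix.mul_apply]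
  have hv : ∏ i, v i = (-1) ^ p * sb := by
    simp only [v, Fintype.prod_sum_type, Sum.elim_inl, Sum.elim_inr, Finset.prod_const_one, mul_one,
      sb, Finset.prod_range]
    simp only [← neg_one_mul ((-1 : R) ^ _), Finset.prod_mul_distrib, Finset.prod_const,
      Finset.card_univ, Fintype.card_fin]
  have hw : ∏ i, w i = sd := by
    simp only [w, Fintype.prod_sum_type, Sum.elim_inl, Sum.elim_inr, Finset.prod_const_one, one_mul,
      sd, Finset.prod_range]
  have hsq : ∀ n : ℕ, ((-1 : R) ^ n) * (-1) ^ n = 1 := by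
    intro n; rw [← pow_add, ← two_mul, pow_mul]; simp
  have hsb : sb * sb = 1 := by
    simp only [sb, ← Finset.prod_mul_distrib, hsq, Finset.prod_const_one]
  have hsd : sd * sd = 1 := by
    simp only [sd, ← Finset.prod_mul_distrib, hsq, Finset.prod_const_one]
  rw [hG, hv, hw, ← hSch, hX1, hX2, hD, hS]
  calc S.det = (((-1 : R) ^ q) * (-1) ^ q) * (((-1 : R) ^ p) * (-1) ^ p) * (sb * sb) * (sd * sd)
        * S.det := by rw [hsq, hsq, hsb, hsd]; simp
    _ = _ := by ring

lemma SchurVn_giambelli {R : Type*} [CommRing R] {N : ℕ} {U : Matrix (Fin N) (Fin N) R}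
    (hU : UpperUni U) (r p q : ℕ) (hrN : r ≤ N) (a b c d : ℕ → ℕ) (ha : SA p a)
    (hb : SA p b) (hc : SA q c) (hd : SA q d)
    (hbr : ∀ j, j < p → b j + 1 ≤ r) (hdr : ∀ j, j < q → d j + 1 ≤ r) :
    SchurVn U r r (frobN p a b) (frobN q c d) =
      (-1) ^ q * detN (p + q) (GM (matExt U) r p a b c d) := by
  rw [SchurVn_eq hU, giambelli hU r p q hrN a b c d hb hd hbr hdr]
  · exact frobN_anti p a b ha hb
  · exact frobN_anti q c d hc hd
  · intro i hi
    exact frobN_eq_zero p a b hb i (fun j hj => by have := hbr j hj; omega)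
  · intro i hi
    exact frobN_eq_zero q c d hd i (fun j hj => by have := hdr j hj; omega)

lemma sk_lt {p k i : ℕ} (h : i < p) : sk k i < p + 1 := by
  unfold sk; split_ifs <;> omega

lemma core {R : Type*} [CommRing R] {N : ℕ} {U : Matrix (Fin N) (Fin N) R}
    (hU : UpperUni U) (r p q : ℕ) (hrN : r ≤ N) (a b c d : ℕ → ℕ) (ha : SA (p + 1) a)
    (hb : SA (p + 1) b) (hc : SA (q + 1) c) (hd : SA (q + 1) d)
    (hbr : ∀ j, j < p + 1 → b j + 1 ≤ r) (hdr : ∀ j, j < q + 1 → d j + 1 ≤ r)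
    (hcN : r + c q ≤ N) :
    SchurVn U r r (frobN (p + 1) a b) (frobN (q + 1) c d) *
      SchurVn U r r (frobN p (fun i => a (i + 1)) (fun i => b (i + 1))) (frobN q c d) =
    SchurVn U r r (frobN (p + 1) a b) (frobN q c d) *
      SchurVn U r r (frobN p (fun i => a (i + 1)) (fun i => b (i + 1))) (frobN (q + 1) c d) +
    ∑ i ∈ range (p + 1), ∑ j ∈ range (p + 1), (-1 : R) ^ (i + j) *
      hSV U (r + c q + 1) ((a i : ℤ) - (c q : ℤ)) *
      eSV U (r - d q - 1) ((b j : ℤ) - (d q : ℤ)) *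
      SchurVn U r r (frobN p (fun k => a (sk i k)) (fun k => b (k + 1))) (frobN q c d) *
      SchurVn U r r (frobN p (fun k => a (k + 1)) (fun k => b (sk j k))) (frobN q c d) := by
  set u := matExt U with hu
  have hbr' : ∀ j, j < p → b (j + 1) + 1 ≤ r := fun j hj => hbr _ (by omega)
  have hdr' : ∀ j, j < q → d j + 1 ≤ r := fun j hj => hdr _ (by omega)
  rw [SchurVn_giambelli hU r (p + 1) (q + 1) hrN a b c d ha hb hc hd hbr hdr,
    SchurVn_giambelli hU r p q hrN _ _ c d ha.shift hb.shift hc.init hd.init hbr' hdr',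
    SchurVn_giambelli hU r (p + 1) q hrN a b c d ha hb hc.init hd.init hbr hdr',
    SchurVn_giambelli hU r p (q + 1) hrN _ _ c d ha.shift hb.shift hc hd hbr' hdr]
  have hsum : ∀ i ∈ range (p + 1), ∀ j ∈ range (p + 1), (-1 : R) ^ (i + j) *
      hSV U (r + c q + 1) ((a i : ℤ) - (c q : ℤ)) *
      eSV U (r - d q - 1) ((b j : ℤ) - (d q : ℤ)) *
      SchurVn U r r (frobN p (fun k => a (sk i k)) (fun k => b (k + 1))) (frobN q c d) *
      SchurVn U r r (frobN p (fun k => a (k + 1)) (fun k => b (sk j k))) (frobN q c d) =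
      ((-1 : R) ^ (p + q + i) * u (r + c q) (r + a i) *
        detN (p + q) (GM u r p (fun k => a (sk i k)) (fun k => b (k + 1)) c d)) *
      ((-1 : R) ^ (p + q + j) * ((-1) ^ (b j + d q) * Vinv u (r - 1 - b j) (r - 1 - d q)) *
        detN (p + q) (GM u r p (fun k => a (k + 1)) (fun k => b (sk j k)) c d)) := by
    intro i hi j hj
    simp only [mem_range] at hi hj
    rw [SchurVn_giambelli hU r p q hrN _ _ c d (ha.skip i) hb.shift hc.init hd.init hbr' hdr',
      SchurVn_giambelli hU r p q hrN _ _ c d ha.shift (hb.skip j) hc.init hd.init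
        (fun k hk => hbr _ (sk_lt hk)) hdr',
      hSV_eq hU r _ _ hcN, eSV_eq U r _ _ (by have := hbr j hj; omega)
        (by have := hdr q (by omega); omega)]
    have h1 : ((-1 : R) ^ (p + q + i)) * (-1) ^ (p + q + j) = (-1) ^ (i + j) := by
      rw [← pow_add, show p + q + i + (p + q + j) = 2 * (p + q) + (i + j) by ring, pow_add, pow_mul]
      simp
    have h2 : ((-1 : R) ^ q) * (-1) ^ q = 1 := by rw [← pow_add, ← two_mul, pow_mul]; simp
    rw [← h1]
    linear_combination (((-1 : R) ^ (p + q + i)) * (-1) ^ (p + q + j) * u (r + c q) (r + a i) *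
      ((-1) ^ (b j + d q) * Vinv u (r - 1 - b j) (r - 1 - d q)) *
        detN (p + q) (GM u r p (fun k => a (sk i k)) (fun k => b (k + 1)) c d) *
        detN (p + q) (GM u r p (fun k => a (k + 1)) (fun k => b (sk j k)) c d)) * h2
  rw [Finset.sum_congr rfl fun i hi => Finset.sum_congr rfl (hsum i hi), ← Finset.sum_mul_sum]
  have e1 : detN (p + q + 1) (fun i j => GM u r (p + 1) a b c d (i + 1) j) =
      ∑ i ∈ range (p + 1), (-1 : R) ^ (p + q + i) * u (r + c q) (r + a i) *
        detN (p + q) (GM u r p (fun k => a (sk i k)) (fun k => b (k + 1)) c d) := by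
    rw [detN_last_row]
    have hr1 : range (p + q + 1) = range ((p + 1) + q) := by congr 1; ring
    rw [hr1, Finset.sum_range_add]
    refine (add_eq_left.mpr ?_).trans ?_
    rotate_left
    · refine Finset.sum_congr rfl fun i hi => ?_
      simp only [mem_range] at hi
      congr 1
      · congr 1
        simp only [GM]
        rw [if_neg (by omega), if_pos hi, show p + q + 1 - (p + 1) = q by omega]
      · refine detN_congr fun x y hx hy => ?_
        have hs : sk i y < p + 1 ↔ y < p := by unfold sk; split_ifs <;> omega
        have hs2 : ¬ y < p → sk i y - (p + 1) = y - p := by unfold sk; split_ifs <;> omega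
        simp only [GM, hs, add_lt_add_iff_right, Nat.add_sub_add_right]
        split_ifs with g1 g2 g2
        · rfl
        · rw [hs2 g2]
        · rfl
        · rfl
    · refine Finset.sum_eq_zero fun i hi => ?_
      simp only [GM]
      rw [if_neg (by omega), if_neg (by omega)]
      simp
  have e2 : detN (p + q + 1) (fun i j => GM u r (p + 1) a b c d i (j + 1)) =
      ∑ j ∈ range (p + 1), (-1 : R) ^ (p + q + j) *
        ((-1) ^ (b j + d q) * Vinv u (r - 1 - b j) (r - 1 - d q)) *
        detN (p + q) (GM u r p (fun k => a (k + 1)) (fun k => b (sk j k)) c d) := by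
    rw [detN_last_col]
    have hr1 : range (p + q + 1) = range ((p + 1) + q) := by congr 1; ring
    rw [hr1, Finset.sum_range_add]
    refine (add_eq_left.mpr ?_).trans ?_
    rotate_left
    · refine Finset.sum_congr rfl fun i hi => ?_
      simp only [mem_range] at hi
      congr 1
      · congr 1
        simp only [GM]
        rw [if_pos hi, if_neg (by omega), show p + q + 1 - (p + 1) = q by omega]
      · refine detN_congr fun x y hx hy => ?_
        have hs : sk i x < p + 1 ↔ x < p := by unfold sk; split_ifs <;> omega
        have hs2 : ¬ x < p → sk i x - (p + 1) = x - p := by unfold sk; split_ifs <;> omega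
        simp only [GM, hs, add_lt_add_iff_right, Nat.add_sub_add_right]
        split_ifs with g1 g2 g2
        · rfl
        · rfl
        · rw [hs2 g1]
        · rfl
    · refine Finset.sum_eq_zero fun i hi => ?_
      simp only [GM]
      rw [if_neg (by omega), if_neg (by omega)]
      simp
  have hsh : ∀ n, detN n (fun i j => GM u r (p + 1) a b c d (i + 1) (j + 1)) =
      detN n (GM u r p (fun i => a (i + 1)) (fun i => b (i + 1)) c d) := by
    intro n
    refine detN_congr fun x y hx hy => ?_
    simp only [GM, add_lt_add_iff_right, Nat.add_sub_add_right]
  have dj := desnanot (p + q) (GM u r (p + 1) a b c d)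
  rw [hsh, hsh, e1, e2] at dj
  rw [show p + 1 + (q + 1) = p + q + 2 by ring, show p + 1 + q = p + q + 1 by ring,
    show p + (q + 1) = p + q + 1 by ring]
  have h2 : ((-1 : R) ^ q) * (-1) ^ q = 1 := by rw [← pow_add, ← two_mul, pow_mul]; simp
  rw [pow_succ]
  set A1 := detN (p + q + 2) (GM u r (p + 1) a b c d)
  set A2 := detN (p + q) (GM u r p (fun i => a (i + 1)) (fun i => b (i + 1)) c d)
  set A3 := detN (p + q + 1) (GM u r (p + 1) a b c d)
  set A4 := detN (p + q + 1) (GM u r p (fun i => a (i + 1)) (fun i => b (i + 1)) c d)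
  linear_combination (-A1 * A2 + A3 * A4) * h2 - dj

/-- Extend a finite sequence by zero. -/
def seqExt {p : ℕ} (α : Fin p → ℕ) : ℕ → ℕ := fun i => if h : i < p then α ⟨i, h⟩ else 0

lemma seqExt_lt {p : ℕ} (α : Fin p → ℕ) {i : ℕ} (h : i < p) : seqExt α i = α ⟨i, h⟩ := by
  simp [seqExt, h]

lemma seqExt_SA {p : ℕ} {α : Fin p → ℕ} (h : StrictAnti α) : SA p (seqExt α) := by
  intro i j hij hj
  rw [seqExt_lt α hj, seqExt_lt α (by omega : i < p)]
  exact h hij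

lemma frobP_frobN {p : ℕ} {α β : Fin p → ℕ} {a b : ℕ → ℕ} (ha : ∀ j : Fin p, α j = a j)
    (hb : ∀ j : Fin p, β j = b j) : frobP p α β = frobN p a b := by
  unfold frobN
  rw [funext ha, funext hb]

/-- Quadratic relation from the Giambelli determinant, skew case. -/
theorem giambelli_quadratic_skew {R : Type*} [CommRing R] {N : ℕ} (hN : 0 < N)
    (U : Matrix (Fin N) (Fin N) R) (hU : UpperUni U)
    (r : ℕ) (hrN : r ≤ N)
    (p q : ℕ) (hp : 1 ≤ p) (hq : 1 ≤ q) (hqp : q ≤ p)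
    (α β : Fin p → ℕ) (γ δ : Fin q → ℕ)
    (hα : StrictAnti α) (hβ : StrictAnti β) (hγ : StrictAnti γ) (hδ : StrictAnti δ)
    (hsub : ∀ i, frobP q γ δ i ≤ frobP p α β i)
    (hht : β ⟨0, by omega⟩ + 1 ≤ r) (hwid : α ⟨0, by omega⟩ + 1 ≤ N - r) :
    SchurVn U r r (frobP p α β) (frobP q γ δ) *
      SchurVn U r r
        (frobP (p - 1) (fun j => α ⟨(j : ℕ) + 1, by have := j.isLt; omega⟩)
          (fun j => β ⟨(j : ℕ) + 1, by have := j.isLt; omega⟩))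
        (frobP (q - 1) (fun j => γ ⟨(j : ℕ), by have := j.isLt; omega⟩)
          (fun j => δ ⟨(j : ℕ), by have := j.isLt; omega⟩)) =
    SchurVn U r r (frobP p α β)
        (frobP (q - 1) (fun j => γ ⟨(j : ℕ), by have := j.isLt; omega⟩)
          (fun j => δ ⟨(j : ℕ), by have := j.isLt; omega⟩)) *
      SchurVn U r r
        (frobP (p - 1) (fun j => α ⟨(j : ℕ) + 1, by have := j.isLt; omega⟩)
          (fun j => β ⟨(j : ℕ) + 1, by have := j.isLt; omega⟩))
        (frobP q γ δ) +
    ∑ i : Fin p, ∑ j : Fin p,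
      (-1 : R) ^ ((i : ℕ) + (j : ℕ)) *
        hSV U (r + γ ⟨q - 1, by omega⟩ + 1) ((α i : ℤ) - (γ ⟨q - 1, by omega⟩ : ℤ)) *
        eSV U (r - δ ⟨q - 1, by omega⟩ - 1) ((β j : ℤ) - (δ ⟨q - 1, by omega⟩ : ℤ)) *
        SchurVn U r r
          (frobP (p - 1)
            (fun j' => if (j' : ℕ) < (i : ℕ) then α ⟨(j' : ℕ), by have := j'.isLt; omega⟩
              else α ⟨(j' : ℕ) + 1, by have := j'.isLt; omega⟩)
            (fun j' => β ⟨(j' : ℕ) + 1, by have := j'.isLt; omega⟩))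
          (frobP (q - 1) (fun j' => γ ⟨(j' : ℕ), by have := j'.isLt; omega⟩)
            (fun j' => δ ⟨(j' : ℕ), by have := j'.isLt; omega⟩)) *
        SchurVn U r r
          (frobP (p - 1) (fun j' => α ⟨(j' : ℕ) + 1, by have := j'.isLt; omega⟩)
            (fun j' => if (j' : ℕ) < (j : ℕ) then β ⟨(j' : ℕ), by have := j'.isLt; omega⟩
              else β ⟨(j' : ℕ) + 1, by have := j'.isLt; omega⟩))
          (frobP (q - 1) (fun j' => γ ⟨(j' : ℕ), by have := j'.isLt; omega⟩)
            (fun j' => δ ⟨(j' : ℕ), by have := j'.isLt; omega⟩)) := by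
  obtain ⟨p, rfl⟩ : ∃ p', p = p' + 1 := ⟨p - 1, by omega⟩
  obtain ⟨q, rfl⟩ : ∃ q', q = q' + 1 := ⟨q - 1, by omega⟩
  have ha := seqExt_SA hα
  have hb := seqExt_SA hβ
  have hc := seqExt_SA hγ
  have hd := seqExt_SA hδ
  have f1 : frobP (p + 1) α β = frobN (p + 1) (seqExt α) (seqExt β) :=
    frobP_frobN (fun j => (seqExt_lt α j.2).symm) (fun j => (seqExt_lt β j.2).symm)
  have f2 : frobP (q + 1) γ δ = frobN (q + 1) (seqExt γ) (seqExt δ) :=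
    frobP_frobN (fun j => (seqExt_lt γ j.2).symm) (fun j => (seqExt_lt δ j.2).symm)
  have b0 : seqExt β 0 + 1 ≤ r := by rw [seqExt_lt β (by omega : 0 < p + 1)]; exact hht
  have a0 : seqExt α 0 + 1 ≤ N - r := by rw [seqExt_lt α (by omega : 0 < p + 1)]; exact hwid
  have hbr : ∀ j, j < p + 1 → seqExt β j + 1 ≤ r := by
    intro j hj
    have := hb.le_zero j hj
    omega
  have hd0 : seqExt δ 0 < r := by
    by_contra hcon
    have h1 := frobN_pos (q + 1) (seqExt γ) (seqExt δ) (by omega)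
    have h2 := hsub (seqExt δ 0)
    rw [f1, f2, frobN_eq_zero (p + 1) (seqExt α) (seqExt β) hb] at h2
    · omega
    · intro j hj
      have := hbr j hj
      omega
  have hdr : ∀ j, j < q + 1 → seqExt δ j + 1 ≤ r := by
    intro j hj
    have := hd.le_zero j hj
    omega
  have hcN : r + seqExt γ q ≤ N := by
    have h2 := hsub 0
    rw [f1, f2, frobN_succ_zero, frobN_succ_zero] at h2
    have := hc.le_zero q (by omega)
    omega
  have key := core hU r p q hrN _ _ _ _ ha hb hc hd hbr hdr hcN
  simp only [Finset.sum_range] at key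
  have f3 : frobP (p + 1 - 1) (fun j => α ⟨(j : ℕ) + 1, by have := j.isLt; omega⟩)
      (fun j => β ⟨(j : ℕ) + 1, by have := j.isLt; omega⟩) =
      frobN p (fun i => seqExt α (i + 1)) (fun i => seqExt β (i + 1)) :=
    frobP_frobN (p := p) (fun j => (seqExt_lt α (by omega)).symm)
      (fun j => (seqExt_lt β (by omega)).symm)
  have f4 : frobP (q + 1 - 1) (fun j => γ ⟨(j : ℕ), by have := j.isLt; omega⟩)
      (fun j => δ ⟨(j : ℕ), by have := j.isLt; omega⟩) =
      frobN q (seqExt γ) (seqExt δ) :=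
    frobP_frobN (p := q) (fun j => (seqExt_lt γ (by omega)).symm)
      (fun j => (seqExt_lt δ (by omega)).symm)
  rw [f1, f2, f3, f4, key]
  congr 1
  refine Finset.sum_congr rfl fun i _ => Finset.sum_congr rfl fun j _ => ?_
  have f5 : frobP (p + 1 - 1)
      (fun j' => if (j' : ℕ) < (i : ℕ) then α ⟨(j' : ℕ), by have := j'.isLt; omega⟩
        else α ⟨(j' : ℕ) + 1, by have := j'.isLt; omega⟩)
      (fun j' => β ⟨(j' : ℕ) + 1, by have := j'.isLt; omega⟩) =
      frobN p (fun k => seqExt α (sk i k)) (fun k => seqExt β (k + 1)) := by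
    refine frobP_frobN (p := p) (fun j' => ?_) (fun j => (seqExt_lt β (by omega)).symm)
    unfold sk
    split_ifs
    · exact (seqExt_lt α (by omega)).symm
    · exact (seqExt_lt α (by omega)).symm
  have f6 : frobP (p + 1 - 1) (fun j' => α ⟨(j' : ℕ) + 1, by have := j'.isLt; omega⟩)
      (fun j' => if (j' : ℕ) < (j : ℕ) then β ⟨(j' : ℕ), by have := j'.isLt; omega⟩
        else β ⟨(j' : ℕ) + 1, by have := j'.isLt; omega⟩) =
      frobN p (fun k => seqExt α (k + 1)) (fun k => seqExt β (sk j k)) := by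
    refine frobP_frobN (p := p) (fun j => (seqExt_lt α (by omega)).symm) (fun j' => ?_)
    unfold sk
    split_ifs
    · exact (seqExt_lt β (by omega)).symm
    · exact (seqExt_lt β (by omega)).symm
  rw [f5, f6, seqExt_lt α i.2, seqExt_lt β j.2, seqExt_lt γ (by omega : q < q + 1),
    seqExt_lt δ (by omega : q < q + 1)]
  rfl
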